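/- (Duality formula, Hermite case.) Let N ≥ 1, m ≥ 1, q = (q_1,…,q_m) with each q_i ∈ ℕ, q_i ≥ 1, |q| := q_1+⋯+q_m, τ(i) := Σ_{l=1}^{i−1} 2q_l, and let μ_1,…,μ_m ∈ ℝ be pairwise distinct. With the Hermite weight ω_N(x) = e^{−2Nx²} on Ω = ℝ one has H_{N,N,m,q}(μ)/H_{N+|q|,N} = h_{N,m,q} · ∏_{i=1}^m (∏_{l=1}^{2q_i} l!)^{−1} · ∏_{i=1}^m e^{4N q_i μ_i²} · ∏_{1≤j<k≤m}(μ_k − μ_j)^{−4 q_j q_k} · I_{N,m,q}(μ), where h_{N,m,q} := ∏_{j=1}^{2|q|} [ √(2N/π) / (i·2^{N+j}) ] · ∏_{i=1}^m ∏_{l=1}^{2q_i} (−2N)^{l−1} · H_{N,N}/H_{N+|q|,N}, and I_{N,m,q}(μ) := ∫_{ℝ^{2|q|}} ∏_{i=1}^m ∏_{l=τ(i)+1}^{τ(i+1)} [ i · (i t_l)^N · e^{−2Nμ_i (i t_l) − N t_l²/2} ] · ∏_{i=1}^m Δ_{2q_i}(i t_{τ(i)+1},…,i t_{τ(i+1)})²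 · ∏_{1≤j<k≤m} ∏_{l_k=τ(k)+1}^{τ(k+1)} ∏_{l_j=τ(j)+1}^{τ(j+1)} (i t_{l_k} − i t_{l_j}) dt, where i is the imaginary unit. -/

import Mathlib

open MeasureTheory Finset

/-- The Vandermonde product for a real tuple. -/
noncomputable def vandR {n : ℕ} (z : Fin n → ℝ) : ℝ :=
  ∏ j : Fin n, ∏ k ∈ Finset.Ioi j, (z k - z j)

/-- The Vandermonde product for a complex tuple. -/
noncomputable def vandC {n : ℕ} (z : Fin n → ℂ) : ℂ :=
  ∏ j : Fin n, ∏ k ∈ Finset.Ioi j, (z k - z j)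

section Gaussian

open Polynomial

/-- The monic Hermite-type polynomials with variance parameter `a` centred at `b`. -/
noncomputable def hermitePoly (a b : ℂ) : ℕ → ℂ[X]
  | 0 => 1
  | n + 1 => (X - C b) * hermitePoly a b n - C a * derivative (hermitePoly a b n)

lemma hermitePoly_monic_natDegree (a b : ℂ) (n : ℕ) :
    (hermitePoly a b n).Monic ∧ (hermitePoly a b n).natDegree = n := by
  induction n with
  | zero => exact ⟨monic_one, natDegree_one⟩
  | succ n ih =>
    obtain ⟨hm, hd⟩ := ih
    have hm' : ((X - C b) * hermitePoly a b n).Monic := (monic_X_sub_C b).mul hm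
    have hd' : ((X - C b) * hermitePoly a b n).natDegree = n + 1 := by
      rw [(monic_X_sub_C b).natDegree_mul hm, natDegree_X_sub_C, hd, add_comm]
    have hlt : (C a * derivative (hermitePoly a b n)).degree
        < ((X - C b) * hermitePoly a b n).degree := by
      refine (degree_le_natDegree.trans ?_).trans_lt
        (b := ((n : ℕ) : WithBot ℕ)) ?_
      · refine Nat.cast_le.mpr ((natDegree_C_mul_le _ _).trans ?_)
        exact (natDegree_derivative_le _).trans (by omega)
      · rw [degree_eq_natDegree hm'.ne_zero, hd']
        exact Nat.cast_lt.mpr (Nat.lt_succ_self n)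
    refine ⟨hm'.sub_of_left hlt, ?_⟩
    rw [hermitePoly, natDegree_sub_eq_left_of_natDegree_lt, hd']
    rw [hd']
    exact Nat.lt_succ_of_le <| (natDegree_C_mul_le _ _).trans <|
      (natDegree_derivative_le _).trans (by omega)

lemma hermitePoly_monic (a b : ℂ) (n : ℕ) : (hermitePoly a b n).Monic :=
  (hermitePoly_monic_natDegree a b n).1

lemma natDegree_hermitePoly (a b : ℂ) (n : ℕ) : (hermitePoly a b n).natDegree = n :=
  (hermitePoly_monic_natDegree a b n).2

lemma derivative_hermitePoly_succ (a b : ℂ) (n : ℕ) :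
    derivative (hermitePoly a b (n + 1)) = (n + 1 : ℂ[X]) * hermitePoly a b n := by
  induction n with
  | zero => simp [hermitePoly]
  | succ n ih =>
    have h : derivative (hermitePoly a b (n + 2)) = hermitePoly a b (n + 1)
        + (X - C b) * derivative (hermitePoly a b (n + 1))
        - C a * derivative (derivative (hermitePoly a b (n + 1))) := by
      rw [hermitePoly]
      simp [derivative_mul]
    have h2 : derivative ((n + 1 : ℂ[X]) * hermitePoly a b n)
        = (n + 1 : ℂ[X]) * derivative (hermitePoly a b n) := by
      simp [derivative_mul]
    rw [h, ih, h2, hermitePoly]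
    push_cast
    ring

lemma iterate_derivative_hermitePoly (a b : ℂ) (n l : ℕ) :
    derivative^[l] (hermitePoly a b n)
      = (n.descFactorial l : ℂ[X]) * hermitePoly a b (n - l) := by
  induction l with
  | zero => simp
  | succ l ih =>
    rw [Function.iterate_succ_apply', ih, derivative_mul, derivative_natCast, zero_mul, zero_add,
      Nat.descFactorial_succ]
    rcases Nat.lt_or_ge l n with h | h
    · obtain ⟨k, hk⟩ : ∃ k, n - l = k + 1 := ⟨n - l - 1, by omega⟩
      rw [hk, derivative_hermitePoly_succ, show n - (l + 1) = k by omega]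
      push_cast
      ring
    · rw [Nat.sub_eq_zero_of_le h]
      simp [hermitePoly]

section Functional

variable {L : ℂ[X] →ₗ[ℂ] ℂ} {a b : ℂ}

lemma functional_hermitePoly_mul (hL : ∀ p, L ((X - C b) * p) = a * L (derivative p)) (n : ℕ)
    (p : ℂ[X]) : L (hermitePoly a b n * p) = a ^ n * L (derivative^[n] p) := by
  induction n generalizing p with
  | zero => simp [hermitePoly]
  | succ n ih =>
    have h : hermitePoly a b (n + 1) * p = (X - C b) * (hermitePoly a b n * p)
        - a • (derivative (hermitePoly a b n) * p) := by
      rw [hermitePoly, smul_eq_C_mul]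
      ring
    rw [h, map_sub, hL, map_smul, derivative_mul, map_add, ih, smul_eq_mul,
      Function.iterate_succ_apply]
    ring

lemma functional_hermitePoly_mul_of_lt (hL : ∀ p, L ((X - C b) * p) = a * L (derivative p))
    {n : ℕ} {p : ℂ[X]} (hp : p.natDegree < n) : L (hermitePoly a b n * p) = 0 := by
  rw [functional_hermitePoly_mul hL, iterate_derivative_eq_zero hp, map_zero, mul_zero]

lemma functional_X_pow (hL : ∀ p, L ((X - C b) * p) = a * L (derivative p)) (n : ℕ) :
    L (X ^ n) = L 1 * 2 ^ n * (hermitePoly (-(a / 4)) 0 n).eval (b / 2) := by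
  induction n using Nat.strong_induction_on with
  | _ n ih =>
    rcases n with _ | _ | n
    · simp [hermitePoly]
    · have h := hL 1
      rw [mul_one, derivative_one, map_zero, mul_zero, map_sub, sub_eq_zero,
        ← mul_one (C b), ← smul_eq_C_mul, map_smul, smul_eq_mul] at h
      simp [hermitePoly, h]
      ring
    · have h := hL (X ^ (n + 1))
      rw [sub_mul, map_sub, ← smul_eq_C_mul, map_smul, ← pow_succ', derivative_X_pow,
        ← smul_eq_C_mul, map_smul, ih (n + 1) (by omega), Nat.add_sub_cancel,
        ih n (by omega), sub_eq_iff_eq_add] at h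
      rw [h, show hermitePoly (-(a / 4)) 0 (n + 1 + 1)
          = (X - C 0) * hermitePoly (-(a / 4)) 0 (n + 1)
            - C (-(a / 4)) * derivative (hermitePoly (-(a / 4)) 0 (n + 1)) from rfl,
        derivative_hermitePoly_succ]
      simp
      ring

lemma functional_hermitePoly_mul_X_pow (hL : ∀ p, L ((X - C b) * p) = a * L (derivative p))
    (l n : ℕ) :
    L (hermitePoly a b l * X ^ n)
      = L 1 * 2 ^ n * (a / 2) ^ l *
        (l.factorial * (taylor (b / 2) (hermitePoly (-(a / 4)) 0 n)).coeff l) := by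
  have h : (l.factorial : ℂ) * (taylor (b / 2) (hermitePoly (-(a / 4)) 0 n)).coeff l
      = (n.descFactorial l : ℂ) * (hermitePoly (-(a / 4)) 0 (n - l)).eval (b / 2) := by
    rw [taylor_coeff]
    have := congrArg (fun f => (f (hermitePoly (-(a / 4)) 0 n)).eval (b / 2))
      (factorial_smul_hasseDeriv (R := ℂ) l)
    simp only [iterate_derivative_hermitePoly] at this
    simpa using this
  rw [h, functional_hermitePoly_mul hL, iterate_derivative_X_pow_eq_natCast_mul,
    ← map_natCast (C : ℂ →+* ℂ[X]), ← smul_eq_C_mul, map_smul, functional_X_pow hL, smul_eq_mul]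
  rcases Nat.lt_or_ge n l with hl | hl
  · simp [Nat.descFactorial_of_lt hl]
  · obtain ⟨k, rfl⟩ := Nat.exists_eq_add_of_le hl
    rw [Nat.add_sub_cancel_left, pow_add, div_pow]
    field_simp

end Functional

lemma integrable_gaussian_mul_polynomial {β : ℝ} (hβ : 0 < β) (ρ : ℝ) (u : ℂ) (p : ℂ[X]) :
    Integrable fun x : ℝ =>
      Complex.exp (-β * x ^ 2 + ρ * Complex.I * x) * p.eval (u * x) := by
  induction p using Polynomial.induction_on' with
  | add p q hp hq =>
    simp only [eval_add, mul_add]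
    exact hp.add hq
  | monomial n c =>
    have h := integrable_rpow_mul_exp_neg_mul_sq hβ (s := n) (by
      have : (0 : ℝ) ≤ n := n.cast_nonneg
      linarith)
    refine (h.const_mul ‖c * u ^ n‖).mono (by fun_prop) (Filter.Eventually.of_forall fun x => ?_)
    have h1 : ‖Complex.exp (-β * x ^ 2 + ρ * Complex.I * x)‖ = Real.exp (-β * x ^ 2) := by
      rw [Complex.norm_exp]
      congr 1
      simp [← Complex.ofReal_pow]
    rw [norm_mul, h1, eval_monomial, mul_pow, Real.norm_eq_abs, abs_mul, abs_mul,
      Real.rpow_natCast, Real.abs_exp, abs_norm]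
    simp only [norm_mul, norm_pow, Complex.norm_real, abs_pow, Real.norm_eq_abs]
    exact le_of_eq (by ring)

/-- Integration of a polynomial in `u x` against the Gaussian kernel `exp (-β x² + ρ i x)`. -/
noncomputable def gaussianFunctional {β : ℝ} (hβ : 0 < β) (ρ : ℝ) (u : ℂ) : ℂ[X] →ₗ[ℂ] ℂ where
  toFun p := ∫ x : ℝ, Complex.exp (-β * x ^ 2 + ρ * Complex.I * x) * p.eval (u * x)
  map_add' p q := by
    rw [← integral_add (integrable_gaussian_mul_polynomial hβ ρ u p)
      (integrable_gaussian_mul_polynomial hβ ρ u q)]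
    simp [mul_add]
  map_smul' c p := by
    rw [RingHom.id_apply, smul_eq_mul, ← integral_const_mul]
    congr 1 with x
    simp
    ring

lemma gaussianFunctional_apply {β : ℝ} (hβ : 0 < β) (ρ : ℝ) (u : ℂ) (p : ℂ[X]) :
    gaussianFunctional hβ ρ u p
      = ∫ x : ℝ, Complex.exp (-β * x ^ 2 + ρ * Complex.I * x) * p.eval (u * x) := rfl

lemma gaussianFunctional_X_sub_C_mul {β : ℝ} (hβ : 0 < β) (ρ : ℝ) {u : ℂ} (hu : u ≠ 0)
    (p : ℂ[X]) :
    gaussianFunctional hβ ρ u ((X - C (ρ * Complex.I * u / (2 * β))) * p)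
      = u ^ 2 / (2 * β) * gaussianFunctional hβ ρ u (derivative p) := by
  have hβ' : (β : ℂ) ≠ 0 := by exact_mod_cast hβ.ne'
  have key : gaussianFunctional hβ ρ u (u • derivative p
      + (-(2 * β / u)) • ((X - C (ρ * Complex.I * u / (2 * β))) * p)) = 0 := by
    rw [gaussianFunctional_apply]
    refine integral_eq_zero_of_hasDerivAt_of_integrable (f := fun x : ℝ =>
      Complex.exp (-β * x ^ 2 + ρ * Complex.I * x) * p.eval (u * x)) (fun x => ?_)
      (integrable_gaussian_mul_polynomial hβ ρ u _) (integrable_gaussian_mul_polynomial hβ ρ u _)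
    have hx : HasDerivAt (fun x : ℝ => (x : ℂ)) 1 x := Complex.ofRealCLM.hasDerivAt
    have h1 := (((hx.pow 2).const_mul (-β : ℂ)).add (hx.const_mul (ρ * Complex.I))).cexp
    have h2 := (p.hasDerivAt (u * x)).comp x (hx.const_mul u)
    refine (h1.mul h2).congr_deriv ?_
    simp only [eval_add, eval_smul, eval_mul, eval_sub, eval_X, eval_C, smul_eq_mul,
      Pi.add_apply, Pi.pow_apply, Function.comp_apply, Nat.cast_ofNat]
    field_simp
    ring
  rw [map_add, map_smul, map_smul, smul_eq_mul, smul_eq_mul] at key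
  generalize gaussianFunctional hβ ρ u ((X - C (ρ * Complex.I * u / (2 * β))) * p) = y at key ⊢
  field_simp
  field_simp at key
  linear_combination -key

end Gaussian

section Determinants

open Polynomial

lemma det_functional_eq_det_functional_X_pow {R : Type*} [Fintype R] [DecidableEq R] {n : ℕ}
    (E : R ≃ Fin n) (φ : R → ℂ[X] →ₗ[ℂ] ℂ) (p : R → ℂ[X])
    (hdeg : ∀ r, (p r).natDegree = E r) (hp : ∀ r, (p r).Monic) :
    (Matrix.of fun r c => φ r (p c)).det = (Matrix.of fun r c => φ r (X ^ (E c : ℕ))).det := by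
  have h : (Matrix.of fun r c => φ r (p c))
      = (Matrix.of fun r c => φ r (X ^ (E c : ℕ)))
        * (Matrix.of fun i j : Fin n => (p (E.symm j)).coeff i).submatrix E E := by
    ext r c
    rw [Matrix.mul_apply]
    simp only [Matrix.of_apply, Matrix.submatrix_apply, Equiv.symm_apply_apply]
    rw [Equiv.sum_comp E (fun i : Fin n => φ r (X ^ (i : ℕ)) * (p c).coeff i),
      Fin.sum_univ_eq_sum_range (fun i => φ r (X ^ i) * (p c).coeff i) n]
    conv_lhs => rw [(p c).as_sum_range_C_mul_X_pow'
      (show (p c).natDegree < n by rw [hdeg]; exact (E c).isLt), map_sum]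
    refine sum_congr rfl fun i _ => ?_
    rw [← smul_eq_C_mul, map_smul, smul_eq_mul, mul_comm]
  rw [h, Matrix.det_mul, Matrix.det_submatrix_equiv_self,
    Matrix.det_matrixOfPolynomials _ (fun i => by rw [hdeg, E.apply_symm_apply])
      (fun i => hp _), mul_one]

lemma vandC_eq_det {n : ℕ} (z : Fin n → ℂ) (p : Fin n → ℂ[X])
    (hdeg : ∀ i, (p i).natDegree = i) (hp : ∀ i, (p i).Monic) :
    vandC z = (Matrix.of fun i j => (p j).eval (z i)).det := by
  rw [← Matrix.det_eval_matrixOfPolynomials_eq_det_vandermonde z p hdeg hp,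
    Matrix.det_vandermonde]
  rfl

variable {m : ℕ} {n : Fin m → ℕ}

lemma val_finSigmaFinEquiv (i : Fin m) (l : Fin (n i)) :
    (finSigmaFinEquiv ⟨i, l⟩ : ℕ) = ∑ j ∈ Iio i, n j + l := by
  rw [finSigmaFinEquiv_apply]
  congr 1
  refine sum_bij (fun j _ => Fin.castLE i.2.le j) (fun j _ => ?_) (fun a _ b _ h => ?_)
    (fun b hb => ?_) (fun _ _ => rfl)
  · exact mem_Iio.mpr (Fin.lt_def.mpr j.2)
  · exact Fin.castLE_injective _ h
  · exact ⟨⟨b, Fin.lt_def.mp (mem_Iio.mp hb)⟩, mem_univ _, rfl⟩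

lemma finSigmaFinEquiv_lt_of_lt {i j : Fin m} (h : i < j) (l : Fin (n i)) (l' : Fin (n j)) :
    finSigmaFinEquiv ⟨i, l⟩ < finSigmaFinEquiv (n := n) ⟨j, l'⟩ := by
  rw [Fin.lt_def, val_finSigmaFinEquiv, val_finSigmaFinEquiv]
  have h1 : ∑ k ∈ insert i (Iio i), n k ≤ ∑ k ∈ Iio j, n k := by
    refine sum_le_sum_of_subset fun k hk => ?_
    rcases mem_insert.mp hk with rfl | hk
    · exact mem_Iio.mpr h
    · exact mem_Iio.mpr ((mem_Iio.mp hk).trans h)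
  rw [sum_insert (by simp)] at h1
  have := l.2
  omega

lemma finSigmaFinEquiv_lt_iff (i : Fin m) (l l' : Fin (n i)) :
    finSigmaFinEquiv ⟨i, l⟩ < finSigmaFinEquiv (n := n) ⟨i, l'⟩ ↔ l < l' := by
  rw [Fin.lt_def, val_finSigmaFinEquiv, val_finSigmaFinEquiv, Fin.lt_def]
  omega

lemma det_sigma_vandermonde (z : (Σ i, Fin (n i)) → ℂ) :
    (Matrix.of fun s s' => z s ^ (finSigmaFinEquiv s' : ℕ)).det
      = (∏ i, vandC fun l => z ⟨i, l⟩) *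
        ∏ j, ∏ k ∈ Ioi j, ∏ lk : Fin (n k), ∏ lj : Fin (n j), (z ⟨k, lk⟩ - z ⟨j, lj⟩) := by
  have h1 : (Matrix.of fun s s' => z s ^ (finSigmaFinEquiv (n := n) s' : ℕ)).det
      = ∏ s, ∏ s', if finSigmaFinEquiv (n := n) s < finSigmaFinEquiv s'
          then z s' - z s else 1 := by
    have := Matrix.det_vandermonde fun a => z (finSigmaFinEquiv.symm a)
    rw [← Matrix.det_submatrix_equiv_self finSigmaFinEquiv] at this
    convert this using 1
    · congr 1
      ext s s'
      simp [Matrix.vandermonde_apply]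
    · rw [← Equiv.prod_comp finSigmaFinEquiv]
      refine prod_congr rfl fun s _ => ?_
      rw [← Finset.filter_lt_eq_Ioi, prod_filter, ← Equiv.prod_comp finSigmaFinEquiv]
      simp
  rw [h1, Fintype.prod_sigma, ← prod_mul_distrib]
  refine prod_congr rfl fun i _ => ?_
  simp_rw [Fintype.prod_sigma]
  rw [prod_comm, ← prod_subset (subset_univ (insert i (Ioi i))), prod_insert (by simp)]
  · congr 1
    · refine prod_congr rfl fun l _ => ?_
      simp_rw [finSigmaFinEquiv_lt_iff]
      rw [← prod_filter, Finset.filter_lt_eq_Ioi]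
    · refine prod_congr rfl fun k hk => ?_
      rw [prod_comm]
      refine prod_congr rfl fun lk _ => prod_congr rfl fun lj _ => ?_
      rw [if_pos (finSigmaFinEquiv_lt_of_lt (mem_Ioi.mp hk) _ _)]
  · intro k _ hk
    have hki : k < i := by
      simp only [mem_insert, mem_Ioi, not_or, not_lt] at hk
      exact lt_of_le_of_ne hk.2 hk.1
    refine prod_eq_one fun l _ => prod_eq_one fun l' _ => ?_
    rw [if_neg (finSigmaFinEquiv_lt_of_lt hki _ _).not_gt]

/-- The confluent Newton basis attached to nodes `μ i` of multiplicity `n i`. -/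
noncomputable def newtonPoly (μ : Fin m → ℂ) (s : Σ i, Fin (n i)) : ℂ[X] :=
  (∏ j ∈ Iio s.1, (X - C (μ j)) ^ n j) * (X - C (μ s.1)) ^ (s.2 : ℕ)

lemma newtonPoly_monic (μ : Fin m → ℂ) (s : Σ i, Fin (n i)) : (newtonPoly μ s).Monic :=
  (monic_prod_of_monic _ _ fun _ _ => (monic_X_sub_C _).pow _).mul ((monic_X_sub_C _).pow _)

lemma natDegree_newtonPoly (μ : Fin m → ℂ) (s : Σ i, Fin (n i)) :
    (newtonPoly μ s).natDegree = finSigmaFinEquiv s := by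
  obtain ⟨i, l⟩ := s
  rw [newtonPoly, (monic_prod_of_monic _ _ fun _ _ => (monic_X_sub_C _).pow _).natDegree_mul
    ((monic_X_sub_C _).pow _), natDegree_prod_of_monic _ _ fun _ _ => (monic_X_sub_C _).pow _,
    val_finSigmaFinEquiv]
  simp [(monic_X_sub_C _).natDegree_pow]

lemma coeff_taylor_mul_X_sub_C_pow (p : ℂ[X]) (b : ℂ) (k l : ℕ) :
    (taylor b (p * (X - C b) ^ k)).coeff l
      = if k ≤ l then (taylor b p).coeff (l - k) else 0 := by
  rw [taylor_mul, taylor_pow, map_sub, taylor_X, taylor_C, add_sub_cancel_right,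
    coeff_mul_X_pow']

lemma det_confluent (μ : Fin m → ℂ) (P : ℂ[X]) :
    (Matrix.of fun s s' : Σ i, Fin (n i) =>
        (taylor (μ s.1) (P * newtonPoly μ s')).coeff s.2).det
      = (∏ i, P.eval (μ i) ^ n i) * ∏ j, ∏ k ∈ Ioi j, (μ k - μ j) ^ (n j * n k) := by
  rw [← Matrix.det_submatrix_equiv_self finSigmaFinEquiv.symm, Matrix.det_of_isLowerTriangular]
  · rw [← Equiv.prod_comp finSigmaFinEquiv]
    simp only [Matrix.submatrix_apply, Equiv.symm_apply_apply, Matrix.of_apply]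
    have hdiag : ∀ s : Σ i, Fin (n i), (taylor (μ s.1) (P * newtonPoly μ s)).coeff s.2
        = P.eval (μ s.1) * ∏ j ∈ Iio s.1, (μ s.1 - μ j) ^ n j := by
      intro s
      rw [newtonPoly, ← mul_assoc, coeff_taylor_mul_X_sub_C_pow, if_pos le_rfl, Nat.sub_self,
        taylor_coeff_zero]
      simp [eval_prod]
    simp_rw [hdiag]
    rw [Fintype.prod_sigma]
    simp only [prod_const, card_univ, Fintype.card_fin, mul_pow, prod_mul_distrib]
    congr 1
    simp_rw [← prod_pow, ← pow_mul]
    exact prod_comm' (by simp)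
  · intro a b hab
    obtain ⟨⟨i, l⟩, rfl⟩ := finSigmaFinEquiv.surjective a
    obtain ⟨⟨j, l'⟩, rfl⟩ := finSigmaFinEquiv.surjective b
    replace hab : finSigmaFinEquiv (n := n) ⟨i, l⟩ < finSigmaFinEquiv ⟨j, l'⟩ := hab
    simp only [Matrix.submatrix_apply, Equiv.symm_apply_apply, Matrix.of_apply]
    rcases lt_trichotomy i j with h | rfl | h
    · rw [newtonPoly, ← mul_prod_erase (Iio j) _ (mem_Iio.mpr h),
        show ∀ a b c d : ℂ[X], a * (b * c * d) = (a * c * d) * b by intros; ring,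
        coeff_taylor_mul_X_sub_C_pow, if_neg (by simp)]
    · rw [finSigmaFinEquiv_lt_iff] at hab
      rw [newtonPoly, ← mul_assoc, coeff_taylor_mul_X_sub_C_pow, if_neg (by simpa using hab)]
    · exact absurd hab (finSigmaFinEquiv_lt_of_lt h _ _).not_gt

end Determinants

section Integration

lemma integrable_det_and_integral_det {ι κ : Type*} [Fintype ι] [Fintype κ] [DecidableEq ι]
    [DecidableEq κ] (f : ι → ι ⊕ κ → ℝ → ℂ) (hf : ∀ i c, Integrable (f i c))
    (A : κ → ι ⊕ κ → ℂ) :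
    Integrable (fun z : ι → ℝ =>
        (Matrix.of (Sum.elim (fun i c => f i c (z i)) A)).det) ∧
      ∫ z : ι → ℝ, (Matrix.of (Sum.elim (fun i c => f i c (z i)) A)).det
        = (Matrix.of (Sum.elim (fun i c => ∫ x, f i c x) A)).det := by
  have hexp : ∀ B : ι → ι ⊕ κ → ℂ, (Matrix.of (Sum.elim B A)).det
      = ∑ σ : Equiv.Perm (ι ⊕ κ), ((Equiv.Perm.sign σ : ℤ) : ℂ)
        * (∏ k, A k (σ (Sum.inr k))) * ∏ i, B i (σ (Sum.inl i)) := by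
    intro B
    rw [← Matrix.det_transpose, Matrix.det_apply']
    refine sum_congr rfl fun σ _ => ?_
    rw [Fintype.prod_sum_type]
    simp only [Matrix.transpose_apply, Matrix.of_apply, Sum.elim_inl, Sum.elim_inr]
    ring
  have hinteg : ∀ σ : Equiv.Perm (ι ⊕ κ), Integrable fun z : ι → ℝ =>
      ((Equiv.Perm.sign σ : ℤ) : ℂ) * (∏ k, A k (σ (Sum.inr k)))
        * ∏ i, f i (σ (Sum.inl i)) (z i) := fun σ =>
    (Integrable.fintype_prod (f := fun i x => f i (σ (Sum.inl i)) x) fun i => hf _ _).const_mul _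
  simp_rw [hexp]
  refine ⟨integrable_finsetSum _ fun σ _ => hinteg σ, ?_⟩
  rw [integral_finsetSum _ fun σ _ => hinteg σ]
  refine sum_congr rfl fun σ _ => ?_
  rw [integral_const_mul, integral_fintype_prod_volume_eq_prod fun i x => f i (σ (Sum.inl i)) x]

lemma integrable_det_and_integral_det_of_rows {ι : Type*} [Fintype ι] [DecidableEq ι]
    (f : ι → ι → ℝ → ℂ) (hf : ∀ i c, Integrable (f i c)) :
    Integrable (fun z : ι → ℝ => (Matrix.of fun i c => f i c (z i)).det) ∧
      ∫ z : ι → ℝ, (Matrix.of fun i c => f i c (z i)).det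
        = (Matrix.of fun i c => ∫ x, f i c x).det := by
  have key : ∀ B : ι → ι → ℂ, (Matrix.of B).det
      = (Matrix.of (Sum.elim (fun i c => B i (Equiv.sumEmpty ι Empty c))
        (fun k _ => k.elim))).det := by
    intro B
    rw [← Matrix.det_submatrix_equiv_self (Equiv.sumEmpty ι Empty)]
    congr 1
    ext (i | i) (j | j)
    · rfl
    · exact j.elim
    · exact i.elim
    · exact i.elim
  have h := integrable_det_and_integral_det (κ := Empty)
    (fun i c => f i (Equiv.sumEmpty ι Empty c)) (fun i c => hf _ _) (fun k _ => k.elim)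
  simpa only [key] using h

lemma integral_sum_mul_eq_card_mul_integral {A ι : Type*} [Fintype A] [Fintype ι]
    (σ : A → Equiv.Perm ι) (χ : A → ℂ) (Φ F : (ι → ℝ) → ℂ)
    (hF : ∀ a t, F (fun i => t (σ a i)) = χ a * F t)
    (hinteg : Integrable fun t => Φ t * F t) :
    ∫ t, (∑ a, χ a * Φ fun i => t (σ a i)) * F t
      = Fintype.card A * ∫ t, Φ t * F t := by
  have hmp : ∀ a, MeasurePreserving (MeasurableEquiv.piCongrLeft (fun _ : ι => ℝ) (σ a).symm)
      volume volume := fun a => volume_measurePreserving_piCongrLeft (fun _ : ι => ℝ) (σ a).symm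
  have hfun : ∀ a t, MeasurableEquiv.piCongrLeft (fun _ : ι => ℝ) (σ a).symm t
      = fun i => t (σ a i) := by
    intro a t
    ext i
    obtain ⟨j, rfl⟩ := (σ a).symm.surjective i
    rw [MeasurableEquiv.coe_piCongrLeft, Equiv.piCongrLeft_apply_apply, Equiv.apply_symm_apply]
  have heq : ∀ t, (∑ a, χ a * Φ fun i => t (σ a i)) * F t
      = ∑ a, (fun t => Φ t * F t)
        (MeasurableEquiv.piCongrLeft (fun _ : ι => ℝ) (σ a).symm t) := by
    intro t
    rw [sum_mul]
    refine sum_congr rfl fun a _ => ?_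
    simp only [hfun, hF]
    ring
  simp_rw [heq]
  rw [integral_finsetSum]
  · simp_rw [fun a => (hmp a).integral_comp' (fun t => Φ t * F t)]
    rw [sum_const, card_univ, nsmul_eq_mul]
  · intro a _
    exact ((hmp a).integrable_comp_emb (MeasurableEquiv.measurableEmbedding _)).mpr hinteg

end Integration

section Duality

open Polynomial

variable {m : ℕ} {n : Fin m → ℕ}

/-- Evaluation at the points `z` followed by Taylor coefficients at the nodes `μ`. -/
noncomputable def nodeFunctional {N : ℕ} (z : Fin N → ℂ) (μ : Fin m → ℂ) :
    Fin N ⊕ (Σ i, Fin (n i)) → ℂ[X] →ₗ[ℂ] ℂ :=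
  Sum.elim (fun l => leval (z l)) (fun s => (lcoeff ℂ s.2) ∘ₗ taylor (μ s.1))

/-- The enumeration of `Fin N ⊕ Σ i, Fin (n i)` in lexicographic order. -/
def finSumSigmaEquiv (N : ℕ) (n : Fin m → ℕ) :
    Fin N ⊕ (Σ i, Fin (n i)) ≃ Fin (N + ∑ i, n i) :=
  (Equiv.sumCongr (Equiv.refl _) finSigmaFinEquiv).trans finSumFinEquiv

lemma val_finSumSigmaEquiv_inl (N : ℕ) (c : Fin N) :
    (finSumSigmaEquiv N n (Sum.inl c) : ℕ) = c := by
  simp [finSumSigmaEquiv]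

lemma val_finSumSigmaEquiv_inr (N : ℕ) (s : Σ i, Fin (n i)) :
    (finSumSigmaEquiv N n (Sum.inr s) : ℕ) = N + finSigmaFinEquiv s := by
  simp [finSumSigmaEquiv]

lemma det_nodeFunctional {N : ℕ} (z : Fin N → ℂ) (μ : Fin m → ℂ) (p : ℕ → ℂ[X])
    (hdeg : ∀ k, (p k).natDegree = k) (hp : ∀ k, (p k).Monic) :
    (Matrix.of fun r c => nodeFunctional (n := n) z μ r (p (finSumSigmaEquiv N n c))).det
      = vandC z * ((∏ l, ∏ i, (μ i - z l) ^ n i)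
        * ∏ j, ∏ k ∈ Ioi j, (μ k - μ j) ^ (n j * n k)) := by
  set P : ℂ[X] := ∏ l, (X - C (z l)) with hP
  have hPm : P.Monic := monic_prod_of_monic _ _ fun _ _ => monic_X_sub_C _
  have hPd : P.natDegree = N := by
    rw [hP, natDegree_prod_of_monic _ _ fun _ _ => monic_X_sub_C _]
    simp
  rw [det_functional_eq_det_functional_X_pow (finSumSigmaEquiv N n)
      (nodeFunctional z μ) _ (fun r => hdeg _) (fun r => hp _),
    ← det_functional_eq_det_functional_X_pow (finSumSigmaEquiv N n)
      (nodeFunctional z μ) (Sum.elim (fun c => X ^ (c : ℕ)) fun s => P * newtonPoly μ s)]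
  · have hblock : (Matrix.of fun r c => nodeFunctional (n := n) z μ r
        (Sum.elim (fun c : Fin N => X ^ (c : ℕ)) (fun s => P * newtonPoly μ s) c))
        = Matrix.fromBlocks (Matrix.of fun l c : Fin N => (X ^ (c : ℕ) : ℂ[X]).eval (z l)) 0
          (Matrix.of fun (s : Σ i, Fin (n i)) (c : Fin N) =>
            (taylor (μ s.1) (X ^ (c : ℕ))).coeff s.2)
          (Matrix.of fun s s' : Σ i, Fin (n i) =>
            (taylor (μ s.1) (P * newtonPoly μ s')).coeff s.2) := by
      ext (r | r) (c | c)
      · rfl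
      · have : P.eval (z r) = 0 := by
          rw [hP, eval_prod]
          exact prod_eq_zero (mem_univ r) (by simp)
        simp [nodeFunctional, this]
      · rfl
      · rfl
    rw [hblock, Matrix.det_fromBlocks_zero₁₂, det_confluent,
      ← vandC_eq_det z (fun c => X ^ (c : ℕ)) (fun c => natDegree_X_pow _)
        (fun c => monic_X_pow _)]
    congr 2
    rw [prod_comm]
    refine prod_congr rfl fun i _ => ?_
    rw [hP, eval_prod, ← prod_pow]
    simp
  · rintro (c | s)
    · simp [val_finSumSigmaEquiv_inl]
    · rw [val_finSumSigmaEquiv_inr, Sum.elim_inr, hPm.natDegree_mul (newtonPoly_monic μ s), hPd,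
        natDegree_newtonPoly]
  · rintro (c | s)
    · exact monic_X_pow _
    · exact hPm.mul (newtonPoly_monic μ s)

lemma integral_vandC_sq_mul_prod {β : ℝ} (hβ : 0 < β) (N : ℕ) (μ : Fin m → ℂ) :
    (∫ z : Fin N → ℝ, vandC (fun l => (z l : ℂ)) ^ 2 * (∏ l, Complex.exp (-β * z l ^ 2))
        * ∏ l, ∏ i, (μ i - z l) ^ n i) * ∏ j, ∏ k ∈ Ioi j, (μ k - μ j) ^ (n j * n k)
      = (N.factorial * ∏ l : Fin N, gaussianFunctional hβ 0 1
          (hermitePoly (1 / (2 * β)) 0 l * hermitePoly (1 / (2 * β)) 0 l))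
        * (Matrix.of fun s s' : Σ i, Fin (n i) => (taylor (μ s.1)
          (hermitePoly (1 / (2 * β)) 0 (N + finSigmaFinEquiv s'))).coeff s.2).det := by
  set p : ℕ → ℂ[X] := hermitePoly (1 / (2 * β)) 0 with hp
  set L := gaussianFunctional hβ 0 1 with hL
  have hrec : ∀ q, L ((X - C 0) * q) = 1 / (2 * β) * L (derivative q) := by
    intro q
    simpa using gaussianFunctional_X_sub_C_mul hβ 0 one_ne_zero q
  set φ : (Fin N → ℝ) → Fin N ⊕ (Σ i, Fin (n i)) → ℂ[X] →ₗ[ℂ] ℂ :=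
    fun z => nodeFunctional (fun l => (z l : ℂ)) μ with hφ
  set F : (Fin N → ℝ) → ℂ := fun z =>
    (Matrix.of fun r c => φ z r (p (finSumSigmaEquiv N n c))).det with hF
  set Φ : (Fin N → ℝ) → ℂ := fun z =>
    ∏ l, (Complex.exp (-β * z l ^ 2) * (p l).eval (z l : ℂ)) with hΦ
  set f : Fin N → Fin N ⊕ (Σ i, Fin (n i)) → ℝ → ℂ := fun l c x =>
    Complex.exp (-β * x ^ 2 + (0 : ℝ) * Complex.I * x)
      * (p l * p (finSumSigmaEquiv N n c)).eval (1 * (x : ℂ)) with hf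
  set A : (Σ i, Fin (n i)) → Fin N ⊕ (Σ i, Fin (n i)) → ℂ := fun s c =>
    (taylor (μ s.1) (p (finSumSigmaEquiv N n c))).coeff s.2 with hA
  have hΦF : ∀ z, Φ z * F z
      = (Matrix.of (Sum.elim (fun l c => f l c (z l)) A)).det := by
    intro z
    have := Matrix.det_mul_column (Sum.elim (fun l : Fin N =>
      Complex.exp (-β * z l ^ 2) * (p l).eval (z l : ℂ)) fun _ : Σ i, Fin (n i) => (1 : ℂ))
      (Matrix.of fun r c => φ z r (p (finSumSigmaEquiv N n c)))
    rw [Fintype.prod_sum_type] at this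
    simp only [Sum.elim_inl, Sum.elim_inr, prod_const_one, mul_one] at this
    rw [hΦ, hF, ← this]
    congr 1
    ext (l | s) c
    · simp [hφ, hf, nodeFunctional, mul_assoc]
    · simp [hφ, hA, nodeFunctional]
  obtain ⟨hinteg, hval⟩ := integrable_det_and_integral_det f
    (fun l c => integrable_gaussian_mul_polynomial hβ 0 1 _) A
  have hanti : ∀ (σ : Equiv.Perm (Fin N)) (z : Fin N → ℝ),
      F (fun i => z (σ i)) = ((Equiv.Perm.sign σ : ℤ) : ℂ) * F z := by
    intro σ z
    have := Matrix.det_permute (Equiv.sumCongr σ (1 : Equiv.Perm (Σ i, Fin (n i))))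
      (Matrix.of fun r c => φ z r (p (finSumSigmaEquiv N n c)))
    rw [show Equiv.Perm.sign (Equiv.sumCongr σ (1 : Equiv.Perm (Σ i, Fin (n i))))
      = Equiv.Perm.sign σ by
        simp] at this
    rw [hF]
    refine Eq.trans (congrArg Matrix.det ?_) this
    ext (l | s) c <;> simp [hφ, nodeFunctional]
  have hsum := integral_sum_mul_eq_card_mul_integral (fun σ : Equiv.Perm (Fin N) => σ)
    (fun σ => ((Equiv.Perm.sign σ : ℤ) : ℂ)) Φ F hanti (by simpa only [hΦF] using hinteg)
  have hpoint : ∀ z : Fin N → ℝ, vandC (fun l => (z l : ℂ)) ^ 2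
      * (∏ l, Complex.exp (-β * z l ^ 2)) * (∏ l, ∏ i, (μ i - z l) ^ n i)
      * ∏ j, ∏ k ∈ Ioi j, (μ k - μ j) ^ (n j * n k)
      = (∑ σ : Equiv.Perm (Fin N), ((Equiv.Perm.sign σ : ℤ) : ℂ) * Φ fun i => z (σ i)) * F z := by
    intro z
    have h1 : (∑ σ : Equiv.Perm (Fin N), ((Equiv.Perm.sign σ : ℤ) : ℂ) * Φ fun i => z (σ i))
        = (∏ l, Complex.exp (-β * z l ^ 2)) * vandC (fun l => (z l : ℂ)) := by
      rw [vandC_eq_det _ (fun c => p c) (fun c => natDegree_hermitePoly _ _ _)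
        (fun c => hermitePoly_monic _ _ _), ← Matrix.det_mul_column, Matrix.det_apply']
      rfl
    rw [h1, hF]
    simp only [hφ]
    rw [det_nodeFunctional _ μ p (natDegree_hermitePoly _ _) (hermitePoly_monic _ _)]
    ring
  rw [← integral_mul_const]
  simp_rw [hpoint]
  rw [hsum, Fintype.card_perm, Fintype.card_fin, mul_assoc]
  simp_rw [hΦF]
  rw [hval]
  congr 1
  have hblock : (Matrix.of (Sum.elim (fun l c => ∫ x, f l c x) A))
      = Matrix.fromBlocks (Matrix.diagonal fun l : Fin N => L (p l * p l)) 0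
        (Matrix.of fun s (c : Fin N) => A s (Sum.inl c))
        (Matrix.of fun s s' : Σ i, Fin (n i) =>
          (taylor (μ s.1) (p (N + finSigmaFinEquiv s'))).coeff s.2) := by
    have hfL : ∀ l c, ∫ x, f l c x = L (p l * p (finSumSigmaEquiv N n c)) := fun _ _ => rfl
    ext (l | s) (c | s')
    · simp only [Matrix.of_apply, Sum.elim_inl, hfL, Matrix.fromBlocks_apply₁₁,
        Matrix.diagonal_apply, val_finSumSigmaEquiv_inl]
      split_ifs with h
      · rw [h]
      · rcases lt_or_gt_of_ne h with h | h
        · rw [mul_comm]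
          exact functional_hermitePoly_mul_of_lt hrec (by rw [natDegree_hermitePoly]; exact h)
        · exact functional_hermitePoly_mul_of_lt hrec (by rw [natDegree_hermitePoly]; exact h)
    · simp only [Matrix.of_apply, Sum.elim_inl, hfL, Matrix.fromBlocks_apply₁₂,
        Matrix.zero_apply, val_finSumSigmaEquiv_inr]
      rw [mul_comm]
      exact functional_hermitePoly_mul_of_lt hrec (by
        rw [natDegree_hermitePoly]
        have := l.2
        omega)
    · rfl
    · simp only [Matrix.of_apply, Sum.elim_inr, Matrix.fromBlocks_apply₂₂, hA,
        val_finSumSigmaEquiv_inr]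
  rw [hblock, Matrix.det_fromBlocks_zero₁₂, Matrix.det_diagonal]

lemma vandC_comp_perm {k : ℕ} (z : Fin k → ℂ) (σ : Equiv.Perm (Fin k)) :
    vandC (fun i => z (σ i)) = ((Equiv.Perm.sign σ : ℤ) : ℂ) * vandC z := by
  have h : ∀ w : Fin k → ℂ, vandC w = (Matrix.vandermonde w).det :=
    fun w => (Matrix.det_vandermonde w).symm
  rw [h, h, ← Matrix.det_permute]
  rfl

lemma integral_prod_mul_vandC_sq {β : ℝ} (hβ : 0 < β) (N : ℕ) (ρ : Fin m → ℝ) (u : ℂ)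
    (a : ℂ) (b : Fin m → ℂ) :
    (∫ t : (Σ i, Fin (n i)) → ℝ,
      (∏ s : Σ i, Fin (n i), (u * t s) ^ N
          * Complex.exp (-β * t s ^ 2 + ρ s.1 * Complex.I * t s))
        * (∏ i, vandC (fun l => u * (t ⟨i, l⟩ : ℂ)) ^ 2)
        * ∏ j, ∏ k ∈ Ioi j, ∏ lk : Fin (n k), ∏ lj : Fin (n j),
          (u * (t ⟨k, lk⟩ : ℂ) - u * (t ⟨j, lj⟩ : ℂ)))
      = (∏ i, ((n i).factorial : ℂ)) * (Matrix.of fun s s' : Σ i, Fin (n i) =>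
          gaussianFunctional hβ (ρ s.1) u
            (hermitePoly a (b s.1) s.2 * X ^ (N + finSigmaFinEquiv s' : ℕ))).det := by
  set Φ : ((Σ i, Fin (n i)) → ℝ) → ℂ := fun t => ∏ s : Σ i, Fin (n i),
    Complex.exp (-β * t s ^ 2 + ρ s.1 * Complex.I * t s)
      * (hermitePoly a (b s.1) s.2).eval (u * t s) with hΦ
  set F : ((Σ i, Fin (n i)) → ℝ) → ℂ := fun t => (∏ s, (u * t s) ^ N)
    * ((∏ i, vandC (fun l => u * (t ⟨i, l⟩ : ℂ)))
      * ∏ j, ∏ k ∈ Ioi j, ∏ lk : Fin (n k), ∏ lj : Fin (n j),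
        (u * (t ⟨k, lk⟩ : ℂ) - u * (t ⟨j, lj⟩ : ℂ))) with hF
  set f : (Σ i, Fin (n i)) → (Σ i, Fin (n i)) → ℝ → ℂ := fun s s' x =>
    Complex.exp (-β * x ^ 2 + ρ s.1 * Complex.I * x)
      * (hermitePoly a (b s.1) s.2 * X ^ (N + finSigmaFinEquiv s' : ℕ)).eval (u * x) with hf
  have hΦF : ∀ t, Φ t * F t = (Matrix.of fun s s' => f s s' (t s)).det := by
    intro t
    rw [hΦ, hF]
    simp only
    rw [← det_sigma_vandermonde (fun s => u * (t s : ℂ)), ← Matrix.det_mul_column,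
      ← Matrix.det_mul_column]
    congr 1
    ext s s'
    simp [hf, pow_add, mul_assoc]
  obtain ⟨hinteg, hval⟩ := integrable_det_and_integral_det_of_rows f
    (fun s s' => integrable_gaussian_mul_polynomial hβ (ρ s.1) u _)
  have hanti : ∀ (σ : ∀ i, Equiv.Perm (Fin (n i))) (t : (Σ i, Fin (n i)) → ℝ),
      F (fun s => t (Equiv.sigmaCongrRight σ s))
        = (∏ i, ((Equiv.Perm.sign (σ i) : ℤ) : ℂ)) * F t := by
    intro σ t
    simp only [hF]
    rw [Equiv.prod_comp (Equiv.sigmaCongrRight σ) fun s => (u * (t s : ℂ)) ^ N]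
    have h1 : ∀ i, vandC (fun l => u * (t (Equiv.sigmaCongrRight σ ⟨i, l⟩) : ℂ))
        = ((Equiv.Perm.sign (σ i) : ℤ) : ℂ) * vandC (fun l => u * (t ⟨i, l⟩ : ℂ)) :=
      fun i => vandC_comp_perm (fun l => u * (t ⟨i, l⟩ : ℂ)) (σ i)
    have h2 : ∀ j k, ∏ lk : Fin (n k), ∏ lj : Fin (n j),
        (u * (t (Equiv.sigmaCongrRight σ ⟨k, lk⟩) : ℂ)
          - u * (t (Equiv.sigmaCongrRight σ ⟨j, lj⟩) : ℂ))
        = ∏ lk : Fin (n k), ∏ lj : Fin (n j),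
          (u * (t ⟨k, lk⟩ : ℂ) - u * (t ⟨j, lj⟩ : ℂ)) := by
      intro j k
      symm
      rw [← Equiv.prod_comp (σ k)]
      refine prod_congr rfl fun lk _ => ?_
      rw [← Equiv.prod_comp (σ j)]
      rfl
    simp_rw [h1, h2, prod_mul_distrib]
    ring
  have hsum := integral_sum_mul_eq_card_mul_integral
    (fun σ : ∀ i, Equiv.Perm (Fin (n i)) => Equiv.sigmaCongrRight σ)
    (fun σ => ∏ i, ((Equiv.Perm.sign (σ i) : ℤ) : ℂ)) Φ F hanti
    (by simpa only [hΦF] using hinteg)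
  have hpoint : ∀ t : (Σ i, Fin (n i)) → ℝ,
      (∏ s : Σ i, Fin (n i), (u * t s) ^ N
          * Complex.exp (-β * t s ^ 2 + ρ s.1 * Complex.I * t s))
        * (∏ i, vandC (fun l => u * (t ⟨i, l⟩ : ℂ)) ^ 2)
        * ∏ j, ∏ k ∈ Ioi j, ∏ lk : Fin (n k), ∏ lj : Fin (n j),
          (u * (t ⟨k, lk⟩ : ℂ) - u * (t ⟨j, lj⟩ : ℂ))
      = (∑ σ : ∀ i, Equiv.Perm (Fin (n i)), (∏ i, ((Equiv.Perm.sign (σ i) : ℤ) : ℂ))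
          * Φ fun s => t (Equiv.sigmaCongrRight σ s)) * F t := by
    intro t
    have h1 : (∑ σ : ∀ i, Equiv.Perm (Fin (n i)), (∏ i, ((Equiv.Perm.sign (σ i) : ℤ) : ℂ))
          * Φ fun s => t (Equiv.sigmaCongrRight σ s))
        = (∏ s : Σ i, Fin (n i), Complex.exp (-β * t s ^ 2 + ρ s.1 * Complex.I * t s))
          * ∏ i, vandC (fun l => u * (t ⟨i, l⟩ : ℂ)) := by
      rw [Fintype.prod_sigma, ← prod_mul_distrib]
      have hi : ∀ i, (∏ l : Fin (n i),
          Complex.exp (-β * t ⟨i, l⟩ ^ 2 + ρ i * Complex.I * t ⟨i, l⟩))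
          * vandC (fun l => u * (t ⟨i, l⟩ : ℂ))
          = ∑ σ : Equiv.Perm (Fin (n i)), ((Equiv.Perm.sign σ : ℤ) : ℂ)
            * ∏ l, (Complex.exp (-β * t ⟨i, σ l⟩ ^ 2 + ρ i * Complex.I * t ⟨i, σ l⟩)
              * (hermitePoly a (b i) l).eval (u * t ⟨i, σ l⟩)) := by
        intro i
        rw [vandC_eq_det _ (fun c => hermitePoly a (b i) c)
          (fun c => natDegree_hermitePoly _ _ _) (fun c => hermitePoly_monic _ _ _),
          ← Matrix.det_mul_column, Matrix.det_apply']
        rfl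
      simp_rw [hi]
      rw [prod_univ_sum, Fintype.piFinset_univ]
      refine sum_congr rfl fun σ _ => ?_
      rw [prod_mul_distrib, hΦ]
      simp only
      rw [Fintype.prod_sigma]
      rfl
    rw [h1, hF]
    simp only [prod_mul_distrib, prod_pow]
    ring
  simp_rw [hpoint]
  rw [hsum]
  simp_rw [hΦF]
  rw [hval]
  congr 1
  simp [Fintype.card_pi, Fintype.card_perm]

end Duality

section Constants

open Polynomial

lemma gaussianFunctional_one {β : ℝ} (hβ : 0 < β) (ρ : ℝ) (u : ℂ) :
    gaussianFunctional hβ ρ u 1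
      = (Real.sqrt (Real.pi / β) : ℂ) * Complex.exp (-ρ ^ 2 / (4 * β)) := by
  have h := integral_cexp_quadratic (b := -(β : ℂ)) (by simpa using hβ) (ρ * Complex.I) 0
  rw [gaussianFunctional_apply]
  simp only [eval_one, mul_one, add_zero] at h ⊢
  rw [h, neg_neg, Real.sqrt_eq_rpow, Complex.ofReal_cpow (by positivity), mul_pow, Complex.I_sq]
  push_cast
  congr 2
  have : (β : ℂ) ≠ 0 := by exact_mod_cast hβ.ne'
  field_simp
  ring

lemma ofReal_vandR {k : ℕ} (z : Fin k → ℝ) : (vandR z : ℂ) = vandC fun l => (z l : ℂ) := by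
  simp [vandR, vandC]

lemma ofReal_integral_vandR_sq {β : ℝ} (hβ : 0 < β) (N : ℕ) :
    ((∫ z : Fin N → ℝ, vandR z ^ 2 * ∏ l, Real.exp (-β * z l ^ 2) : ℝ) : ℂ)
      = N.factorial * ∏ l : Fin N, gaussianFunctional hβ 0 1
          (hermitePoly (1 / (2 * β)) 0 l * hermitePoly (1 / (2 * β)) 0 l) := by
  have h := integral_vandC_sq_mul_prod (n := (Fin.elim0 : Fin 0 → ℕ)) hβ N Fin.elim0
  rw [Matrix.det_isEmpty] at h
  simp only [univ_eq_empty, prod_empty, prod_const_one, mul_one] at h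
  rw [← h, ← integral_complex_ofReal]
  congr 1 with z
  push_cast [ofReal_vandR]
  rfl

lemma ofReal_integral_vandR_sq_mul_prod {m : ℕ} {n : Fin m → ℕ} {β : ℝ} (hβ : 0 < β) (N : ℕ)
    (μ : Fin m → ℝ) (hn : ∀ i, Even (n i)) :
    ((∫ z : Fin N → ℝ, vandR z ^ 2 * (∏ l, Real.exp (-β * z l ^ 2))
        * ∏ l, ∏ i, |μ i - z l| ^ n i : ℝ) : ℂ)
        * ∏ j, ∏ k ∈ Ioi j, ((μ k : ℂ) - μ j) ^ (n j * n k)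
      = ((∫ z : Fin N → ℝ, vandR z ^ 2 * ∏ l, Real.exp (-β * z l ^ 2) : ℝ) : ℂ)
        * (Matrix.of fun s s' : Σ i, Fin (n i) => (taylor (μ s.1 : ℂ)
          (hermitePoly (1 / (2 * β)) 0 (N + finSigmaFinEquiv s'))).coeff s.2).det := by
  rw [ofReal_integral_vandR_sq hβ, ← integral_vandC_sq_mul_prod hβ N fun i => (μ i : ℂ),
    ← integral_complex_ofReal]
  congr 2 with z
  simp only [(hn _).pow_abs]
  push_cast [ofReal_vandR]
  rfl

lemma dual_integral_eq {m : ℕ} {n : Fin m → ℕ} {N : ℕ} (hN : 1 ≤ N) (μ : Fin m → ℝ) :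
    (∫ t : (Σ i : Fin m, Fin (n i)) → ℝ,
      (∏ s : Σ i : Fin m, Fin (n i),
          Complex.I * (Complex.I * (t s : ℂ)) ^ N *
            Complex.exp (-2 * N * (μ s.1 : ℂ) * (Complex.I * (t s : ℂ)) -
              N * (t s : ℂ) ^ 2 / 2)) *
        (∏ i : Fin m, vandC (fun l : Fin (n i) => Complex.I * (t ⟨i, l⟩ : ℂ)) ^ 2) *
        ∏ j : Fin m, ∏ k ∈ Finset.Ioi j, ∏ lk : Fin (n k), ∏ lj : Fin (n j),
          (Complex.I * (t ⟨k, lk⟩ : ℂ) - Complex.I * (t ⟨j, lj⟩ : ℂ)))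
      = Complex.I ^ (∑ i, n i) * (∏ i, ((n i).factorial : ℂ)) *
        ((∏ i, ∏ l : Fin (n i), ((Real.sqrt (2 * Real.pi / N) : ℂ)
            * Complex.exp (-2 * N * (μ i : ℂ) ^ 2) * (-2 * (N : ℂ))⁻¹ ^ (l : ℕ)
            * ((l : ℕ).factorial : ℂ)))
          * (∏ j : Fin (∑ i, n i), (2 : ℂ) ^ (N + (j : ℕ)))
          * (Matrix.of fun s s' : Σ i, Fin (n i) => (taylor (μ s.1 : ℂ)
            (hermitePoly (1 / (2 * (2 * N : ℝ))) 0 (N + finSigmaFinEquiv s'))).coeff s.2).det) := by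
  have hN0 : (N : ℂ) ≠ 0 := by exact_mod_cast (by omega : N ≠ 0)
  have hβ : (0 : ℝ) < N / 2 := by
    have : (0 : ℝ) < N := by exact_mod_cast hN
    positivity
  have h := integral_prod_mul_vandC_sq (n := n) hβ N (fun i => -2 * N * μ i) Complex.I
    (-1 / N) (fun i => 2 * μ i)
  have hrec : ∀ (i : Fin m) (p : ℂ[X]),
      gaussianFunctional hβ (-2 * N * μ i) Complex.I ((X - C (2 * (μ i : ℂ))) * p)
        = -1 / N * gaussianFunctional hβ (-2 * N * μ i) Complex.I (derivative p) := by
    intro i p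
    have := gaussianFunctional_X_sub_C_mul hβ (-2 * N * μ i) Complex.I_ne_zero p
    have ha : Complex.I ^ 2 / (2 * ((N / 2 : ℝ) : ℂ)) = -1 / N := by
      rw [Complex.I_sq]
      push_cast
      field_simp
    have hb : ((-2 * N * μ i : ℝ) : ℂ) * Complex.I * Complex.I / (2 * ((N / 2 : ℝ) : ℂ))
        = 2 * μ i := by
      rw [mul_assoc _ Complex.I, Complex.I_mul_I]
      push_cast
      field_simp
    rwa [hb, ha] at this
  have hone : ∀ i : Fin m, gaussianFunctional hβ (-2 * N * μ i) Complex.I 1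
      = (Real.sqrt (2 * Real.pi / N) : ℂ) * Complex.exp (-2 * N * (μ i : ℂ) ^ 2) := by
    intro i
    rw [gaussianFunctional_one]
    congr 2
    · rw [div_div_eq_mul_div, mul_comm]
    · push_cast
      field_simp
      ring
  have hentry : (Matrix.of fun s s' : Σ i, Fin (n i) =>
      gaussianFunctional hβ (-2 * N * μ s.1) Complex.I
        (hermitePoly (-1 / N) (2 * μ s.1) s.2 * X ^ (N + finSigmaFinEquiv s' : ℕ)))
      = Matrix.of fun s s' : Σ i, Fin (n i) => ((Real.sqrt (2 * Real.pi / N) : ℂ)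
            * Complex.exp (-2 * N * (μ s.1 : ℂ) ^ 2) * (-2 * (N : ℂ))⁻¹ ^ (s.2 : ℕ)
            * ((s.2 : ℕ).factorial : ℂ)) * (Matrix.of fun s s' : Σ i, Fin (n i) =>
          2 ^ (N + finSigmaFinEquiv s' : ℕ) * (Matrix.of fun s s' => (taylor (μ s.1 : ℂ)
          (hermitePoly (1 / (2 * (2 * N : ℝ))) 0 (N + finSigmaFinEquiv s'))).coeff s.2)
            s s') s s' := by
    ext s s'
    have h1 : -((-1 / (N : ℂ)) / 4) = 1 / (2 * (2 * N : ℝ)) := by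
      push_cast
      field_simp
      ring
    have h2 : (-1 / (N : ℂ)) / 2 = (-2 * (N : ℂ))⁻¹ := by
      field_simp
    simp only [Matrix.of_apply]
    rw [functional_hermitePoly_mul_X_pow (hrec s.1), hone, h1, h2,
      mul_div_cancel_left₀ _ (two_ne_zero : (2 : ℂ) ≠ 0)]
    ring
  rw [hentry, Matrix.det_mul_column, Matrix.det_mul_row, Fintype.prod_sigma,
    Equiv.prod_comp finSigmaFinEquiv fun j : Fin (∑ i, n i) => (2 : ℂ) ^ (N + (j : ℕ))] at h
  rw [mul_assoc (Complex.I ^ _), mul_assoc (∏ i, ∏ l, _)]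
  refine Eq.trans ?_ (congrArg (Complex.I ^ (∑ i, n i) * ·) h)
  rw [← integral_const_mul]
  congr 1 with t
  have hI : ∀ s : Σ i, Fin (n i), Complex.I * (Complex.I * (t s : ℂ)) ^ N *
      Complex.exp (-2 * N * (μ s.1 : ℂ) * (Complex.I * (t s : ℂ)) - N * (t s : ℂ) ^ 2 / 2)
      = Complex.I * ((Complex.I * (t s : ℂ)) ^ N * Complex.exp (-((N / 2 : ℝ) : ℂ) * t s ^ 2
        + ((-2 * N * μ s.1 : ℝ) : ℂ) * Complex.I * t s)) := by
    intro s
    rw [mul_assoc]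
    congr 3
    push_cast
    ring
  simp_rw [hI]
  rw [prod_mul_distrib, prod_const, card_univ, Fintype.card_sigma]
  simp only [Fintype.card_fin]
  ring

lemma prod_factorial_mul_factorial (k : ℕ) :
    (∏ l : Fin k, ((l : ℕ).factorial : ℂ)) * k.factorial
      = ∏ l ∈ Icc 1 k, (l.factorial : ℂ) := by
  rw [Fin.prod_univ_eq_prod_range fun l => (l.factorial : ℂ), ← prod_range_succ,
    prod_range_succ', Nat.factorial_zero, Nat.cast_one, mul_one, range_eq_Ico,
    prod_Ico_add' (fun l => (l.factorial : ℂ)) 0 k 1]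
  rfl

lemma sqrt_mul_sqrt_div_two {N : ℕ} (hN : 1 ≤ N) :
    (Real.sqrt (2 * Real.pi / N) : ℂ) * (Real.sqrt (2 * N / Real.pi) / 2) = 1 := by
  have hN0 : (0 : ℝ) < N := by exact_mod_cast hN
  rw [← mul_div_assoc, ← Complex.ofReal_mul, ← Real.sqrt_mul (by positivity),
    show 2 * Real.pi / N * (2 * N / Real.pi) = 2 ^ 2 by field_simp,
    Real.sqrt_sq (by norm_num)]
  norm_num

lemma block_constant_eq_one {N : ℕ} (hN : 1 ≤ N) (k : ℕ) (x : ℝ) :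
    (∏ l : Fin (2 * k), (-2 * (N : ℂ)) ^ (l : ℕ))
      * (∏ l ∈ Icc 1 (2 * k), (l.factorial : ℂ))⁻¹
      * (Real.exp (4 * N * k * x ^ 2) : ℂ)
      * ((2 * k).factorial * ∏ l : Fin (2 * k), ((Real.sqrt (2 * Real.pi / N) : ℂ)
            * Complex.exp (-2 * N * (x : ℂ) ^ 2) * (-2 * (N : ℂ))⁻¹ ^ (l : ℕ)
            * ((l : ℕ).factorial : ℂ)))
      * (Real.sqrt (2 * N / Real.pi) / 2 : ℂ) ^ (2 * k) = 1 := by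
  have hN0 : (-2 * (N : ℂ)) ≠ 0 := by
    simpa using (by omega : N ≠ 0)
  have hexp : (Real.exp (4 * N * k * x ^ 2) : ℂ)
      * Complex.exp (-2 * N * (x : ℂ) ^ 2) ^ (2 * k) = 1 := by
    rw [← Complex.exp_nat_mul, Complex.ofReal_exp, ← Complex.exp_add, ← Complex.exp_zero]
    congr 1
    push_cast
    ring
  have hpow : (∏ l : Fin (2 * k), (-2 * (N : ℂ)) ^ (l : ℕ))
      * ∏ l : Fin (2 * k), (-2 * (N : ℂ))⁻¹ ^ (l : ℕ) = 1 := by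
    rw [← prod_mul_distrib]
    exact prod_eq_one fun l _ => by rw [← mul_pow, mul_inv_cancel₀ hN0, one_pow]
  have hsqrt : (Real.sqrt (2 * Real.pi / N) : ℂ) ^ (2 * k)
      * (Real.sqrt (2 * N / Real.pi) / 2 : ℂ) ^ (2 * k) = 1 := by
    rw [← mul_pow, sqrt_mul_sqrt_div_two hN, one_pow]
  have hfact : (∏ l ∈ Icc 1 (2 * k), (l.factorial : ℂ)) ≠ 0 :=
    prod_ne_zero_iff.2 fun l _ => by exact_mod_cast l.factorial_ne_zero
  have hfact' := inv_mul_cancel₀ hfact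
  rw [← prod_factorial_mul_factorial] at hfact' ⊢
  simp only [prod_mul_distrib, prod_const, card_univ, Fintype.card_fin]
  linear_combination (congrArg₂ (· * ·) (congrArg₂ (· * ·) hexp hpow)
    (congrArg₂ (· * ·) hsqrt hfact'))

lemma contour_constant_eq (N K : ℕ) (s : ℂ) :
    (∏ j : Fin K, s / (Complex.I * 2 ^ (N + (j : ℕ) + 1))) * Complex.I ^ K
      * ∏ j : Fin K, (2 : ℂ) ^ (N + (j : ℕ)) = (s / 2) ^ K := by
  have hI : (Complex.I ^ K : ℂ) = ∏ _j : Fin K, Complex.I := by simp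
  rw [hI, ← prod_mul_distrib, ← prod_mul_distrib]
  trans ∏ _j : Fin K, s / 2
  · refine prod_congr rfl fun j _ => ?_
    have := Complex.I_ne_zero
    field_simp
    ring
  · rw [prod_const, card_univ, Fintype.card_fin]

end Constants

/-- duality formula, Hermite case.  For the Hermite weight
`ω_N(x) = e^{-2Nx²}` on `ℝ`,
`H_{N,N,m,q}(μ)/H_{N+|q|,N} = h_{N,m,q} ∏_i (∏_{l=1}^{2q_i} l!)⁻¹ ∏_i e^{4Nq_iμ_i²}
  ∏_{j<k}(μ_k-μ_j)^{-4q_jq_k} · I_{N,m,q}(μ)`,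
where `I` is the `2|q|`-fold integral over the contour `z = it` (variables grouped in
blocks via the sigma type `Σ i, Fin (2 q i)`). -/
theorem duality_formula_hermite
    (N : ℕ) (hN : 1 ≤ N) (m : ℕ) (hm : 1 ≤ m)
    (q : Fin m → ℕ) (hq : ∀ i, 1 ≤ q i)
    (μ : Fin m → ℝ) (hμ : Function.Injective μ) :
    ((∫ z : Fin N → ℝ,
          vandR z ^ 2 * (∏ l, Real.exp (-2 * N * (z l) ^ 2)) *
            ∏ l, ∏ i, |μ i - z l| ^ (2 * q i)) /
        (∫ z : Fin (N + ∑ i, q i) → ℝ,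
          vandR z ^ 2 * ∏ l, Real.exp (-2 * N * (z l) ^ 2)) : ℝ)
    = ((∏ j : Fin (2 * ∑ i, q i),
            ((Real.sqrt (2 * N / Real.pi) : ℂ) / (Complex.I * 2 ^ (N + (j : ℕ) + 1)))) *
          (∏ i : Fin m, ∏ l : Fin (2 * q i), (-2 * (N : ℂ)) ^ (l : ℕ)) *
          (((∫ z : Fin N → ℝ, vandR z ^ 2 * ∏ l, Real.exp (-2 * N * (z l) ^ 2)) /
              (∫ z : Fin (N + ∑ i, q i) → ℝ,
                vandR z ^ 2 * ∏ l, Real.exp (-2 * N * (z l) ^ 2)) : ℝ) : ℂ)) *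
        (∏ i : Fin m, (∏ l ∈ Finset.Icc 1 (2 * q i), (l.factorial : ℂ))⁻¹) *
        (∏ i : Fin m, (Real.exp (4 * N * (q i) * (μ i) ^ 2) : ℂ)) *
        (∏ j : Fin m, ∏ k ∈ Finset.Ioi j,
            ((μ k - μ j : ℝ) : ℂ) ^ (-(4 * (q j : ℤ) * (q k : ℤ)))) *
        ∫ t : (Σ i : Fin m, Fin (2 * q i)) → ℝ,
          (∏ s : Σ i : Fin m, Fin (2 * q i),
              Complex.I * (Complex.I * (t s : ℂ)) ^ N *
                Complex.exp (-2 * N * (μ s.1 : ℂ) * (Complex.I * (t s : ℂ)) -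
                  N * (t s : ℂ) ^ 2 / 2)) *
            (∏ i : Fin m, vandC (fun l : Fin (2 * q i) => Complex.I * (t ⟨i, l⟩ : ℂ)) ^ 2) *
            ∏ j : Fin m, ∏ k ∈ Finset.Ioi j, ∏ lk : Fin (2 * q k), ∏ lj : Fin (2 * q j),
              (Complex.I * (t ⟨k, lk⟩ : ℂ) - Complex.I * (t ⟨j, lj⟩ : ℂ)) := by
  have hmain := ofReal_integral_vandR_sq_mul_prod (n := fun i => 2 * q i) (β := 2 * N)
    (by have : (0 : ℝ) < N := by exact_mod_cast hN
        positivity) N μ fun i => even_two_mul _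
  rw [dual_integral_eq (n := fun i => 2 * q i) hN μ]
  simp only [← neg_mul] at hmain
  generalize Matrix.det (R := ℂ) (n := Σ i : Fin m, Fin (2 * q i)) _ = X at hmain ⊢
  have hcontour := contour_constant_eq N (∑ i, 2 * q i) (Real.sqrt (2 * N / Real.pi))
  have hblock := prod_eq_one fun i (_ : i ∈ univ) => block_constant_eq_one hN (q i) (μ i)
  rw [prod_mul_distrib, prod_mul_distrib, prod_mul_distrib, prod_mul_distrib, prod_mul_distrib,
    prod_pow_eq_pow_sum] at hblock
  have hvand : (∏ j : Fin m, ∏ k ∈ Finset.Ioi j,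
      ((μ k - μ j : ℝ) : ℂ) ^ (-(4 * (q j : ℤ) * (q k : ℤ))))
      * ∏ j, ∏ k ∈ Ioi j, ((μ k : ℂ) - μ j) ^ (2 * q j * (2 * q k)) = 1 := by
    simp only [← prod_mul_distrib]
    refine prod_eq_one fun j _ => prod_eq_one fun k hk => ?_
    have hne : ((μ k : ℂ) - μ j) ≠ 0 :=
      sub_ne_zero.2 <| Complex.ofReal_injective.ne <| hμ.ne (mem_Ioi.1 hk).ne'
    rw [← zpow_natCast, Complex.ofReal_sub, ← zpow_add₀ hne, ← zpow_zero ((μ k : ℂ) - μ j)]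
    congr 1
    push_cast
    ring
  have key : ∀ A B Z K P F E V W U G R T S : ℂ, A * W = B * X → V * W = 1 → K * U * T = S →
      P * F * E * (G * R) * S = 1 →
      A / Z = K * P * (B / Z) * F * E * V * (U * G * (R * T * X)) := by
    intro A B Z K P F E V W U G R T S h₁ h₂ h₃ h₄
    linear_combination (-(B / Z * V * X * P * F * E * G * R)) * h₃ - (B / Z * V * X) * h₄
      + V / Z * h₁ - A / Z * h₂
  rw [Fin.prod_univ_eq_prod_range (fun j => (Real.sqrt (2 * N / Real.pi) : ℂ)
    / (Complex.I * 2 ^ (N + j + 1))), Finset.mul_sum, ← Fin.prod_univ_eq_prod_range,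
    Complex.ofReal_div, Complex.ofReal_div]
  exact key _ _ _ _ _ _ _ _ _ _ _ _ _ _ hmain hvand hcontour hblock
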